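/- arXiv:0808.2543 — 2 statements merged into one kernel-verified Lean document; each statement's English description precedes it below -/
import Mathlib

section
/- Let (H,σ) be a difference field of characteristic zero with K := const(H,σ), and let H(t) be a ΠΣ*-extension of (H,σ). Inside an ambient difference field, let H(t) = G₀ ⊆ G₁ ⊆ … ⊆ G_e be a tower where each G_i = G_{i−1}(x_i), each x_i is transcendental over G_{i−1}, const(G_i,σ) = K, and for every i either σ(x_i) − x_i ∈ H(x₁,…,x_{i−1}) or (x_i ≠ 0 and σ(x_i)/x_i ∈ H(x₁,…,x_{i−1})), where H(x₁,…,x_{i−1}) denotes the subfield generated by H and x₁,…,x_{i−1} (so the defining elements are free of t). Let h₁,…,h_n ∈ H(t) be proper fractions in t over H. If c₁,…,c_n ∈ K and g ∈ G_e is a proper fraction in t over H(x₁,…,x_e) (i.e. g = U(t)/V(t) with U, V polynomials with coefficients in H(x₁,…,x_e) and deg U < deg V) such that σ(g) − g = c₁·h₁ + … + c_n·h_n, then g ∈ H(t) and g is a proper fraction in t over H. -/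
/-- `L(t)`: the subfield generated by the subfield `L` and the element `t`. -/
def adj {E : Type*} [Field E] (L : Subfield E) (t : E) : Subfield E :=
  Subfield.closure ((L : Set E) ∪ {t})

/-- The subfield generated by the subfield `H` and a set `S` of elements. -/
def adjS {E : Type*} [Field E] (H : Subfield E) (S : Set E) : Subfield E :=
  Subfield.closure ((H : Set E) ∪ S)

/-- The set of constants of the subfield `L` with respect to the automorphism `σ`. -/
def constSet {E : Type*} [Field E] (σ : E ≃+* E) (L : Subfield E) : Set E :=
  {c : E | c ∈ L ∧ σ c = c}

/-- A polynomial with all coefficients in the subfield `L`. -/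
def polyOver {E : Type*} [Field E] (L : Subfield E) (P : Polynomial E) : Prop :=
  ∀ n, P.coeff n ∈ L

/-- `g` is a proper fraction in `t` over `L`: `g = U(t)/V(t)` with `deg U < deg V`. -/
def isProperFrac {E : Type*} [Field E] (L : Subfield E) (t g : E) : Prop :=
  ∃ U V : Polynomial E, polyOver L U ∧ polyOver L V ∧ U.degree < V.degree ∧
    g = Polynomial.eval t U / Polynomial.eval t V

open Polynomial

section Adjoin

variable {E : Type*} [Field E] {L : Subfield E} {t : E}

theorem le_adj : L ≤ adj L t := fun _ ha => Subfield.subset_closure (Or.inl ha)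

theorem self_mem_adj : t ∈ adj L t := Subfield.subset_closure (Or.inr rfl)

theorem adj_eq_toSubfield : adj L t = (IntermediateField.adjoin L {t}).toSubfield := by
  rw [IntermediateField.adjoin_toSubfield, adj]
  congr 2
  exact Subtype.range_coe.symm

theorem mem_adj_iff {z : E} : z ∈ adj L t ↔ ∃ r s : L[X], z = aeval t r / aeval t s := by
  rw [adj_eq_toSubfield]
  exact IntermediateField.mem_adjoin_simple_iff (F := L) z

theorem adj_comm {s : E} : adj (adj L s) t = adj (adj L t) s := by
  have key : ∀ a b : E, adj (adj L a) b ≤ adj (adj L b) a := by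
    intro a b
    refine Subfield.closure_le.2 (Set.union_subset ?_ ?_)
    · refine Subfield.closure_le.2 (Set.union_subset ?_ ?_)
      · exact fun z hz => le_adj (le_adj hz)
      · rintro _ rfl
        exact self_mem_adj
    · rintro _ rfl
      exact le_adj self_mem_adj
  exact le_antisymm (key s t) (key t s)

theorem adjS_image_succ (x : ℕ → E) (i : ℕ) :
    adjS L (x '' {j | j < i + 1}) = adj (adjS L (x '' {j | j < i})) (x i) := by
  refine le_antisymm (Subfield.closure_le.2 (Set.union_subset ?_ ?_))
    (Subfield.closure_le.2 (Set.union_subset ?_ ?_))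
  · exact fun z hz => le_adj (Subfield.subset_closure (Or.inl hz))
  · rintro _ ⟨j, hj, rfl⟩
    rcases Nat.lt_succ_iff_lt_or_eq.1 hj with hj | rfl
    · exact le_adj (Subfield.subset_closure (Or.inr ⟨j, hj, rfl⟩))
    · exact self_mem_adj
  · exact Subfield.closure_mono (Set.union_subset_union_right _
      (Set.image_mono fun j (hj : j < i) => Nat.lt_succ_of_lt hj))
  · rintro _ rfl
    exact Subfield.subset_closure (Or.inr ⟨i, Nat.lt_succ_self i, rfl⟩)

theorem adjS_image_zero (x : ℕ → E) : adjS L (x '' {j | j < 0}) = L := by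
  simp [adjS]

theorem Transcendental.of_le {M : Subfield E} (h : L ≤ M) (ht : Transcendental M t) :
    Transcendental L t := by
  rintro ⟨p, hp, hpt⟩
  refine ht ⟨p.map (Subfield.inclusion h), ?_, ?_⟩
  · exact (Polynomial.map_ne_zero_iff (RingHom.injective _)).2 hp
  · rw [aeval_def, eval₂_map]
    exact hpt

open scoped IntermediateField.algebraAdjoinAdjoin in
theorem Transcendental.adj_exchange {s : E} (ht : Transcendental L t)
    (hs : Transcendental (adj L t) s) : Transcendental (adj L s) t := by
  intro halg
  rw [adj_eq_toSubfield] at halg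
  have hs' : Transcendental L s := hs.of_le le_adj
  have h1 : IsAlgebraic (Algebra.adjoin L {s}) t :=
    (IsFractionRing.isAlgebraic_iff (Algebra.adjoin L {s})
      (IntermediateField.adjoin L {s}) E).2 halg
  have h2 := IsAlgebraic.adjoin_singleton (A := E) (B := E) hs' ht h1
  have h3 : IsAlgebraic (IntermediateField.adjoin L {t}) s :=
    (IsFractionRing.isAlgebraic_iff (Algebra.adjoin L {t})
      (IntermediateField.adjoin L {t}) E).1 h2
  rw [adj_eq_toSubfield] at hs
  exact hs h3

theorem polyOver_map (p : L[X]) : polyOver L (p.map L.subtype) := fun n => by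
  rw [coeff_map]
  exact (p.coeff n).2

theorem polyOver.exists_map {P : E[X]} (hP : polyOver L P) :
    ∃ p : L[X], p.map L.subtype = P := by
  have : P ∈ lifts L.subtype := by
    rw [lifts_iff_coeff_lifts]
    intro n
    exact ⟨⟨_, hP n⟩, rfl⟩
  exact this

theorem polyOver.mono {M : Subfield E} (h : L ≤ M) {P : E[X]} (hP : polyOver L P) :
    polyOver M P := fun n => h (hP n)

theorem polyOver.sub {P Q : E[X]} (hP : polyOver L P) (hQ : polyOver L Q) :
    polyOver L (P - Q) := fun n => by
  rw [coeff_sub]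
  exact sub_mem (hP n) (hQ n)

theorem polyOver.mul {P Q : E[X]} (hP : polyOver L P) (hQ : polyOver L Q) :
    polyOver L (P * Q) := fun n => by
  rw [coeff_mul]
  exact sum_mem fun i _ => mul_mem (hP _) (hQ _)

theorem polyOver.eval_mem {P : E[X]} (hP : polyOver L P) : P.eval t ∈ adj L t := by
  rw [eval_eq_sum_range]
  exact sum_mem fun i _ => mul_mem (le_adj (hP i)) (pow_mem self_mem_adj i)

theorem polyOver.eq_zero_of_eval_eq_zero {P : E[X]} (hP : polyOver L P)
    (ht : Transcendental L t) (h : P.eval t = 0) : P = 0 := by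
  obtain ⟨p, rfl⟩ := hP.exists_map
  have : p = 0 := by
    by_contra hp
    refine ht ⟨p, hp, ?_⟩
    rw [eval_map] at h
    exact h
  rw [this, Polynomial.map_zero]

theorem isProperFrac.mem_adj {g : E} (h : isProperFrac L t g) : g ∈ adj L t := by
  obtain ⟨U, V, hU, hV, -, rfl⟩ := h
  exact div_mem hU.eval_mem hV.eval_mem

/-- A polynomial expression in a transcendental element is a proper fraction only if it is zero. -/
theorem isProperFrac.eq_zero_of_polyOver {P : E[X]} (ht : Transcendental L t)
    (hP : polyOver L P) (h : isProperFrac L t (P.eval t)) : P = 0 := by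
  obtain ⟨U, V, hU, hV, hdeg, h⟩ := h
  have hV0 : V ≠ 0 := ne_zero_of_degree_gt hdeg
  have hVt : V.eval t ≠ 0 := fun h0 => hV0 (hV.eq_zero_of_eval_eq_zero ht h0)
  have : P * V - U = 0 := by
    refine ((hP.mul hV).sub hU).eq_zero_of_eval_eq_zero ht ?_
    rw [eval_sub, eval_mul, h, div_mul_cancel₀ _ hVt, sub_self]
  by_contra hP0
  rw [sub_eq_zero] at this
  rw [← this, degree_mul] at hdeg
  refine absurd hdeg (not_lt.2 ?_)
  exact le_add_of_nonneg_left (zero_le_degree_iff.2 hP0)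

theorem isProperFrac.mono {M : Subfield E} (h : L ≤ M) {g : E} (hg : isProperFrac L t g) :
    isProperFrac M t g := by
  obtain ⟨U, V, hU, hV, hdeg, hg⟩ := hg
  exact ⟨U, V, hU.mono h, hV.mono h, hdeg, hg⟩

theorem isProperFrac.sub {g₁ g₂ : E} (ht : Transcendental L t) (h₁ : isProperFrac L t g₁)
    (h₂ : isProperFrac L t g₂) : isProperFrac L t (g₁ - g₂) := by
  obtain ⟨U₁, V₁, hU₁, hV₁, hdeg₁, rfl⟩ := h₁
  obtain ⟨U₂, V₂, hU₂, hV₂, hdeg₂, rfl⟩ := h₂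
  have hV₁0 : V₁ ≠ 0 := ne_zero_of_degree_gt hdeg₁
  have hV₂0 : V₂ ≠ 0 := ne_zero_of_degree_gt hdeg₂
  have hV₁t : V₁.eval t ≠ 0 := fun h0 => hV₁0 (hV₁.eq_zero_of_eval_eq_zero ht h0)
  have hV₂t : V₂.eval t ≠ 0 := fun h0 => hV₂0 (hV₂.eq_zero_of_eval_eq_zero ht h0)
  refine ⟨U₁ * V₂ - V₁ * U₂, V₁ * V₂, (hU₁.mul hV₂).sub (hV₁.mul hU₂), hV₁.mul hV₂, ?_, ?_⟩
  · refine (degree_sub_le _ _).trans_lt (max_lt ?_ ?_)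
    · rw [degree_mul, degree_mul]
      exact WithBot.add_lt_add_right (degree_ne_bot.2 hV₂0) hdeg₁
    · rw [degree_mul, degree_mul]
      exact WithBot.add_lt_add_left (degree_ne_bot.2 hV₁0) hdeg₂
  · rw [div_sub_div _ _ hV₁t hV₂t]
    simp

/-- An element of `L(t)` that is a proper fraction in `t` over a larger field is already
a proper fraction over `L`. -/
theorem isProperFrac.descend {M : Subfield E} (h : L ≤ M) (ht : Transcendental M t) {g : E}
    (hg : isProperFrac M t g) (hgL : g ∈ adj L t) : isProperFrac L t g := by
  obtain ⟨r, s, hrs⟩ := mem_adj_iff.1 hgL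
  by_cases hs : s = 0
  · refine ⟨0, 1, fun n => by simp [zero_mem], fun n => ?_, by simp, by simp [hrs, hs]⟩
    rw [coeff_one]
    split_ifs
    exacts [one_mem _, zero_mem _]
  have htL : Transcendental L t := ht.of_le h
  have hst : aeval t s ≠ 0 := fun h0 => htL ⟨s, hs, h0⟩
  have hrem : isProperFrac L t (aeval t (r % s) / aeval t s) := by
    refine ⟨(r % s).map L.subtype, s.map L.subtype, polyOver_map _, polyOver_map _, ?_, ?_⟩
    · rw [degree_map, degree_map]
      exact EuclideanDomain.mod_lt r hs
    · rw [eval_map, eval_map]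
      rfl
  have hquot : g - aeval t (r % s) / aeval t s = ((r / s).map L.subtype).eval t := by
    have : ((r / s).map L.subtype).eval t = aeval t (r / s) := by
      rw [eval_map]
      rfl
    rw [this, hrs, ← sub_div, ← map_sub, div_eq_iff hst, ← map_mul]
    congr 1
    rw [sub_eq_iff_eq_add, mul_comm]
    exact (EuclideanDomain.div_add_mod r s).symm
  have h0 := hg.sub ht (hrem.mono h)
  rw [hquot] at h0
  have hz := h0.eq_zero_of_polyOver ht ((polyOver_map _).mono h)
  rw [hz, eval_zero, sub_eq_zero] at hquot
  rwa [hquot]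

end Adjoin

section Derivation

variable {E : Type*} [Field E]

/-- The function `D` restricts to a derivation from the subfield `L` to the ambient field. -/
structure IsDerivationOn (L : Subfield E) (D : E → E) : Prop where
  map_add : ∀ a ∈ L, ∀ b ∈ L, D (a + b) = D a + D b
  map_mul : ∀ a ∈ L, ∀ b ∈ L, D (a * b) = D a * b + a * D b

namespace IsDerivationOn

variable {L : Subfield E} {D : E → E}

theorem map_zero (hD : IsDerivationOn L D) : D 0 = 0 := by
  simpa using hD.map_add 0 (zero_mem _) 0 (zero_mem _)

theorem map_one (hD : IsDerivationOn L D) : D 1 = 0 := by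
  simpa using hD.map_mul 1 (one_mem _) 1 (one_mem _)

theorem map_neg (hD : IsDerivationOn L D) {a : E} (ha : a ∈ L) : D (-a) = -D a := by
  have h := hD.map_add a ha (-a) (neg_mem ha)
  rw [add_neg_cancel, hD.map_zero] at h
  linear_combination -h

theorem map_sub (hD : IsDerivationOn L D)
    {a b : E} (ha : a ∈ L) (hb : b ∈ L) : D (a - b) = D a - D b := by
  rw [sub_eq_add_neg, hD.map_add a ha _ (neg_mem hb), hD.map_neg hb, sub_eq_add_neg]

theorem map_inv (hD : IsDerivationOn L D) {a : E} (ha : a ∈ L) : D a⁻¹ = -D a / a ^ 2 := by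
  by_cases h0 : a = 0
  · simp [h0, hD.map_zero]
  have h := hD.map_mul a ha a⁻¹ (inv_mem ha)
  rw [mul_inv_cancel₀ h0, hD.map_one] at h
  field_simp
  field_simp at h
  linear_combination -h

theorem map_div (hD : IsDerivationOn L D) {a b : E} (ha : a ∈ L) (hb : b ∈ L) (hb0 : b ≠ 0) :
    D (a / b) = (D a * b - a * D b) / b ^ 2 := by
  rw [div_eq_mul_inv, hD.map_mul a ha _ (inv_mem hb), hD.map_inv hb]
  field_simp
  ring

theorem map_pow_eq_zero (hD : IsDerivationOn L D)
    {t : E} (ht : t ∈ L) (hDt : D t = 0) (n : ℕ) : D (t ^ n) = 0 := by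
  induction n with
  | zero => rw [pow_zero, hD.map_one]
  | succ n ih => rw [pow_succ, hD.map_mul _ (pow_mem ht n) t ht, ih, hDt]; simp

theorem map_sum (hD : IsDerivationOn L D)
    {ι : Type*} (s : Finset ι) (f : ι → E) (hf : ∀ i ∈ s, f i ∈ L) :
    D (∑ i ∈ s, f i) = ∑ i ∈ s, D (f i) := by
  classical
  induction s using Finset.induction_on with
  | empty => simpa using hD.map_zero
  | insert i s hi ih =>
    have hs : ∀ j ∈ s, f j ∈ L := fun j hj => hf j (Finset.mem_insert_of_mem hj)
    rw [Finset.sum_insert hi, Finset.sum_insert hi,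
      hD.map_add _ (hf i (Finset.mem_insert_self i s)) _ (sum_mem hs), ih hs]

/-- A derivation of `L` maps `M(s)` to itself if it maps the generators into `M(s)`. -/
theorem map_mem_adj (hD : IsDerivationOn L D) {M : Subfield E} {s : E} (hML : adj M s ≤ L)
    (hM : ∀ a ∈ M, D a ∈ adj M s) (hs : D s ∈ adj M s) {z : E} (hz : z ∈ adj M s) :
    D z ∈ adj M s := by
  induction hz using Subfield.closure_induction with
  | mem a ha =>
    rcases ha with ha | rfl
    exacts [hM a ha, hs]
  | one => rw [hD.map_one]; exact zero_mem _
  | add a b ha hb iha ihb => rw [hD.map_add a (hML ha) b (hML hb)]; exact add_mem iha ihb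
  | neg a ha iha => rw [hD.map_neg (hML ha)]; exact neg_mem iha
  | inv a ha iha => rw [hD.map_inv (hML ha)]; exact div_mem (neg_mem iha) (pow_mem ha 2)
  | mul a b ha hb iha ihb =>
    rw [hD.map_mul a (hML ha) b (hML hb)]
    exact add_mem (mul_mem iha hb) (mul_mem ha ihb)

/-- A derivation commutes with an automorphism on `M(s)` if it does so on the generators. -/
theorem comm_on_adj (hD : IsDerivationOn L D)
    {σ : E ≃+* E} {M : Subfield E} {s : E} (hL : L = adj M s)
    (hσL : ∀ a ∈ L, σ a ∈ L) (hM : ∀ a ∈ M, D (σ a) = σ (D a)) (hs : D (σ s) = σ (D s))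
    {z : E} (hz : z ∈ L) : D (σ z) = σ (D z) := by
  subst hL
  induction hz using Subfield.closure_induction with
  | mem a ha =>
    rcases ha with ha | rfl
    exacts [hM a ha, hs]
  | one => simp [hD.map_one]
  | add a b ha hb iha ihb =>
    rw [_root_.map_add, hD.map_add _ (hσL a ha) _ (hσL b hb), hD.map_add a ha b hb, iha, ihb,
      _root_.map_add]
  | neg a ha iha => rw [_root_.map_neg, hD.map_neg (hσL a ha), hD.map_neg ha, iha, _root_.map_neg]
  | inv a ha iha => rw [map_inv₀, hD.map_inv (hσL a ha), hD.map_inv ha, iha]; simp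
  | mul a b ha hb iha ihb =>
    rw [_root_.map_mul, hD.map_mul _ (hσL a ha) _ (hσL b hb), hD.map_mul a ha b hb, iha, ihb]
    simp

/-- A derivation that kills `t` and preserves `M` maps polynomial expressions in `t` over `M`
to polynomial expressions of no larger degree. -/
theorem exists_eval_eq (hD : IsDerivationOn L D)
    {M : Subfield E} {t : E} (hML : M ≤ L) (hM : ∀ a ∈ M, D a ∈ M)
    (ht : t ∈ L) (hDt : D t = 0) {P : E[X]} (hP : polyOver M P) :
    ∃ Q : E[X], polyOver M Q ∧ Q.degree ≤ P.degree ∧ D (P.eval t) = Q.eval t := by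
  refine ⟨∑ i ∈ P.support, monomial i (D (P.coeff i)), fun n => ?_, ?_, ?_⟩
  · rw [finsetSum_coeff]
    refine sum_mem fun i _ => ?_
    rw [coeff_monomial]
    split_ifs
    exacts [hM _ (hP i), zero_mem _]
  · exact (degree_sum_le _ _).trans (Finset.sup_le fun i hi =>
      (degree_monomial_le _ _).trans (le_degree_of_mem_supp i hi))
  · rw [eval_eq_sum, Polynomial.sum, hD.map_sum _ _ fun i _ =>
      mul_mem (hML (hP i)) (pow_mem ht i), eval_finsetSum]
    refine Finset.sum_congr rfl fun i _ => ?_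
    rw [hD.map_mul _ (hML (hP i)) _ (pow_mem ht i), hD.map_pow_eq_zero ht hDt, eval_monomial]
    simp

/-- A derivation that kills `t` and preserves `M` maps proper fractions in `t` over `M` to
proper fractions. -/
theorem isProperFrac_map (hD : IsDerivationOn L D)
    {M : Subfield E} {t : E} (hML : M ≤ L) (hM : ∀ a ∈ M, D a ∈ M)
    (ht : t ∈ L) (hDt : D t = 0) (htr : Transcendental M t) {g : E} (hg : isProperFrac M t g) :
    isProperFrac M t (D g) := by
  obtain ⟨U, V, hU, hV, hdeg, rfl⟩ := hg
  have hV0 : V ≠ 0 := ne_zero_of_degree_gt hdeg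
  have hVt : V.eval t ≠ 0 := fun h0 => hV0 (hV.eq_zero_of_eval_eq_zero htr h0)
  obtain ⟨U', hU', hdegU, hDU⟩ := hD.exists_eval_eq hML hM ht hDt hU
  obtain ⟨V', hV', hdegV, hDV⟩ := hD.exists_eval_eq hML hM ht hDt hV
  have hle : adj M t ≤ L := Subfield.closure_le.2 (Set.union_subset hML (by simpa using ht))
  refine ⟨U' * V - U * V', V * V, (hU'.mul hV).sub (hU.mul hV'), hV.mul hV, ?_, ?_⟩
  · have hlt : U.degree + V.degree < V.degree + V.degree :=
      WithBot.add_lt_add_right (degree_ne_bot.2 hV0) hdeg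
    refine (degree_sub_le _ _).trans_lt (max_lt ?_ ?_)
    · rw [degree_mul, degree_mul]
      exact (add_le_add_left hdegU _).trans_lt hlt
    · rw [degree_mul, degree_mul]
      exact (add_le_add_right hdegV _).trans_lt hlt
  · rw [hD.map_div (hle hU.eval_mem) (hle hV.eval_mem) hVt, hDU, hDV]
    simp [sq]

end IsDerivationOn

/-- On the rational function field `N(x)` there is an `N`-derivation with any prescribed value
at `x`. -/
theorem exists_isDerivationOn_adj {N : Subfield E} {x : E} (hx : Transcendental N x) (y : E) :
    ∃ D : E → E, IsDerivationOn (adj N x) D ∧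
      ∀ p : N[X], D (aeval x p) = aeval x (derivative p) * y := by
  classical
  let φ : N[X] →+* TrivSqZeroExt E E :=
    eval₂RingHom ((TrivSqZeroExt.inlHom E E).comp N.subtype)
      (TrivSqZeroExt.inl x + TrivSqZeroExt.inr y)
  have hφ : ∀ p : N[X], (φ p).fst = aeval x p ∧ (φ p).snd = aeval x (derivative p) * y := by
    intro p
    induction p using Polynomial.induction_on with
    | C a => simp [φ]; rfl
    | add p q hp hq =>
      rw [_root_.map_add, TrivSqZeroExt.fst_add, TrivSqZeroExt.snd_add, hp.1, hp.2, hq.1, hq.2]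
      simp [add_mul]
    | monomial n a h =>
      rw [pow_succ, ← mul_assoc, _root_.map_mul, TrivSqZeroExt.fst_mul, TrivSqZeroExt.snd_mul,
        h.1, h.2]
      have hX : φ X = TrivSqZeroExt.inl x + TrivSqZeroExt.inr y := by simp [φ]
      rw [hX]
      refine ⟨by simp, ?_⟩
      rw [derivative_mul (g := X)]
      simp
      ring
  have hunit : ∀ q : nonZeroDivisors N[X], IsUnit (φ q) := by
    intro q
    rw [TrivSqZeroExt.isUnit_iff_isUnit_fst, (hφ _).1, isUnit_iff_ne_zero]
    exact fun h0 => hx ⟨q, nonZeroDivisors.ne_zero q.2, h0⟩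
  let Φ : RatFunc N →+* TrivSqZeroExt E E := IsLocalization.lift hunit
  have hΦ : ∀ p : N[X], Φ (algebraMap _ _ p) = φ p := fun p => IsLocalization.lift_eq hunit p
  let e := RatFunc.algEquivOfTranscendental x hx
  have hfst : ∀ r : RatFunc N, (Φ r).fst = (e r : E) := by
    intro r
    have : (TrivSqZeroExt.fstHom E E E).toRingHom.comp Φ =
        (IntermediateField.adjoin N {x}).val.toRingHom.comp e.toAlgHom.toRingHom := by
      refine IsLocalization.ringHom_ext (nonZeroDivisors N[X]) ?_
      refine RingHom.ext fun p => ?_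
      change (Φ (algebraMap _ _ p)).fst = (e (algebraMap _ _ p) : E)
      rw [hΦ, (hφ p).1]
      simp [e]
    exact DFunLike.congr_fun this r
  have hmem : ∀ {z : E}, z ∈ adj N x → z ∈ IntermediateField.adjoin N {x} := fun hz => by
    rwa [adj_eq_toSubfield] at hz
  refine ⟨fun z => if hz : z ∈ adj N x then (Φ (e.symm ⟨z, hmem hz⟩)).snd else 0,
    ⟨fun a ha b hb => ?_, fun a ha b hb => ?_⟩, fun p => ?_⟩
  · simp only [dif_pos ha, dif_pos hb, dif_pos (add_mem ha hb)]
    rw [← TrivSqZeroExt.snd_add, ← _root_.map_add, ← _root_.map_add]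
    rfl
  · simp only [dif_pos ha, dif_pos hb, dif_pos (mul_mem ha hb)]
    have : (⟨a * b, hmem (mul_mem ha hb)⟩ : IntermediateField.adjoin N {x}) =
      ⟨a, hmem ha⟩ * ⟨b, hmem hb⟩ := rfl
    rw [this, _root_.map_mul, _root_.map_mul, TrivSqZeroExt.snd_mul, hfst, hfst]
    simp
    ring
  · have hp : aeval x p ∈ adj N x := mem_adj_iff.2 ⟨p, 1, by simp⟩
    simp only [dif_pos hp]
    rw [← (hφ p).2, ← hΦ]
    congr 2
    rw [AlgEquiv.symm_apply_eq]
    ext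
    simp [e]

/-- In characteristic zero the kernel of a nontrivial `N`-derivation of `N(x)` is `N`. -/
theorem IsDerivationOn.mem_of_eq_zero [CharZero E] {N : Subfield E} {x y : E} {D : E → E}
    (hD : IsDerivationOn (adj N x) D) (hx : Transcendental N x)
    (hDp : ∀ p : N[X], D (aeval x p) = aeval x (derivative p) * y) (hy : y ≠ 0)
    {z : E} (hz : z ∈ adj N x) (hDz : D z = 0) : z ∈ N := by
  have hz' : z ∈ IntermediateField.adjoin N {x} := by rwa [adj_eq_toSubfield] at hz
  obtain ⟨r, hr⟩ := (RatFunc.algEquivOfTranscendental x hx).surjective ⟨z, hz'⟩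
  have hzr : z = aeval x r.num / aeval x r.denom := by
    rw [← RatFunc.algEquivOfTranscendental_apply x hx, hr]
  have haeval : ∀ p : N[X], aeval x p = 0 → p = 0 := fun p h => by
    by_contra hp
    exact hx ⟨p, hp, h⟩
  have hq : aeval x r.denom ≠ 0 := fun h => r.denom_ne_zero (haeval _ h)
  have hmem : ∀ p : N[X], aeval x p ∈ adj N x := fun p => mem_adj_iff.2 ⟨p, 1, by simp⟩
  rw [hzr, hD.map_div (hmem _) (hmem _) hq, hDp, hDp, div_eq_zero_iff] at hDz
  have hpoly : derivative r.num * r.denom - r.num * derivative r.denom = 0 := by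
    refine haeval _ (mul_right_cancel₀ hy ?_)
    rw [_root_.map_sub, _root_.map_mul, _root_.map_mul]
    linear_combination hDz.resolve_right (pow_ne_zero 2 hq)
  rw [sub_eq_zero] at hpoly
  have hdvd : r.denom ∣ derivative r.denom :=
    r.isCoprime_num_denom.symm.dvd_of_dvd_mul_left ⟨derivative r.num, by rw [← hpoly, mul_comm]⟩
  have hdenom : derivative r.denom = 0 :=
    eq_zero_of_dvd_of_degree_lt hdvd (degree_derivative_lt r.denom_ne_zero)
  have hnum : derivative r.num = 0 := by
    rw [hdenom, mul_zero] at hpoly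
    exact (mul_eq_zero.1 hpoly).resolve_right r.denom_ne_zero
  have hC : ∀ p : N[X], derivative p = 0 → aeval x p ∈ N := fun p hp => by
    rw [eq_C_of_natDegree_eq_zero (derivative_eq_zero.1 hp), aeval_C]
    exact (p.coeff 0).2
  rw [hzr]
  exact div_mem (hC _ hnum) (hC _ hdenom)

end Derivation

section Telescoping

variable {E : Type*} [Field E] {σ : E ≃+* E}

theorem adj_mono {L M : Subfield E} {t : E} (h : L ≤ M) : adj L t ≤ adj M t :=
  Subfield.closure_mono (Set.union_subset_union_left _ h)

theorem map_mem_adj_of_generators {L : Subfield E} {s : E} (hL : ∀ a ∈ L, σ a ∈ adj L s)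
    (hs : σ s ∈ adj L s) : ∀ a ∈ adj L s, σ a ∈ adj L s := by
  have : adj L s ≤ (adj L s).comap (σ : E →+* E) := by
    refine Subfield.closure_le.2 (Set.union_subset hL ?_)
    rintro _ rfl
    exact hs
  exact fun a ha => this ha

/-- A proper fraction `g` in `t` over `F(x)` with `σ g - g ∈ F(t)` is a proper fraction over `F`,
if `x` generates a `ΠΣ*`-extension of `F(t)` that is defined over `F`. -/
theorem isProperFrac_of_telescoping [CharZero E] {F : Subfield E} {t x g : E}
    (ht : Transcendental F t) (hx : Transcendental (adj F t) x)
    (hσ : ∀ a ∈ adj F t, σ a ∈ adj F t)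
    (hxPS : σ x - x ∈ F ∨ (x ≠ 0 ∧ σ x / x ∈ F))
    (hconst : ∀ a ∈ adj (adj F t) x, σ a = a → a ∈ F)
    (hg : isProperFrac (adj F x) t g) (hf : σ g - g ∈ adj F t) :
    isProperFrac F t g := by
  set N := adj F t with hN
  have htx : Transcendental (adj F x) t := ht.adj_exchange hx
  have hx0 : x ≠ 0 := by
    rintro rfl
    exact hx isAlgebraic_zero
  have hσx : σ x ∈ adj N x := by
    rcases hxPS with h | ⟨-, h⟩
    · simpa using add_mem (le_adj (le_adj h)) (self_mem_adj (L := N) (t := x))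
    · simpa [hx0] using mul_mem (le_adj (le_adj h)) (self_mem_adj (L := N) (t := x))
  have hσL : ∀ a ∈ adj N x, σ a ∈ adj N x :=
    map_mem_adj_of_generators (fun a ha => le_adj (hσ a ha)) hσx
  have hFN : adj F x ≤ adj N x := adj_mono le_adj
  have hgL : g ∈ adj N x := by
    rw [hN, adj_comm]
    exact hg.mem_adj
  obtain ⟨y, hy0, hyF, hyσ⟩ : ∃ y : E, y ≠ 0 ∧ y ∈ adj F x ∧
      ∀ D : E → E, IsDerivationOn (adj N x) D → (∀ a ∈ N, D a = 0) → D x = y →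
        D (σ x) = σ y := by
    rcases hxPS with h | ⟨-, h⟩
    · refine ⟨1, one_ne_zero, one_mem _, fun D hD hDN hDx => ?_⟩
      have h1 := hD.map_sub hσx (self_mem_adj (L := N))
      rw [hDN _ (le_adj h), hDx] at h1
      rw [_root_.map_one]
      linear_combination -h1
    · refine ⟨x, hx0, self_mem_adj, fun D hD hDN hDx => ?_⟩
      have h1 := hD.map_mul _ (le_adj (le_adj h)) x (self_mem_adj (L := N))
      rwa [hDN _ (le_adj h), hDx, div_mul_cancel₀ _ hx0, zero_mul, zero_add] at h1
  obtain ⟨D, hD, hDp⟩ := exists_isDerivationOn_adj hx y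
  have hDN : ∀ a ∈ N, D a = 0 := fun a ha => by
    have := hDp (C ⟨a, ha⟩)
    rw [derivative_C, _root_.map_zero, zero_mul, aeval_C] at this
    exact this
  have hDx : D x = y := by simpa using hDp X
  have hDF : ∀ a ∈ adj F x, D a ∈ adj F x := fun a ha =>
    hD.map_mem_adj hFN (fun b hb => by rw [hDN b (le_adj hb)]; exact zero_mem _)
      (hDx ▸ hyF) ha
  have hcomm : D (σ g) = σ (D g) :=
    hD.comm_on_adj rfl hσL (fun a ha => by rw [hDN a ha, hDN _ (hσ a ha), _root_.map_zero])
      (by rw [hDx]; exact hyσ D hD hDN hDx) hgL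
  have hDgL : D g ∈ adj N x :=
    hD.map_mem_adj le_rfl (fun b hb => by rw [hDN b hb]; exact zero_mem _)
      (hDx ▸ hFN hyF) hgL
  have hDgσ : σ (D g) = D g := by
    have h1 := hD.map_sub (hσL g hgL) hgL
    rw [hDN _ hf, hcomm] at h1
    exact (sub_eq_zero.1 h1.symm)
  have hDgF : D g ∈ F := hconst _ hDgL hDgσ
  have hDgfrac : isProperFrac (adj F x) t (D g) :=
    hD.isProperFrac_map hFN hDF (le_adj self_mem_adj) (hDN t self_mem_adj) htx hg
  have hDg0 : D g = 0 := by
    have hpoly : polyOver (adj F x) (C (D g)) := fun n => by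
      rw [coeff_C]
      split_ifs
      exacts [le_adj hDgF, zero_mem _]
    rw [← eval_C (x := t) (a := D g)] at hDgfrac
    exact C_eq_zero.1 (hDgfrac.eq_zero_of_polyOver htx hpoly)
  exact hg.descend le_adj htx (hD.mem_of_eq_zero hx hDp hy0 hgL hDg0)

end Telescoping

/-- Proper-fraction solutions of parameterized telescoping are not affected by
ΠΣ*-extensions whose generators are free of `t`: if the `hᵢ` are proper fractions
in `t` over `H` and `g` is a proper fraction in `t` over `H(x₁,…,x_e)` solving
`σ(g) - g = Σ cᵢ·hᵢ`, then `g ∈ H(t)` and `g` is a proper fraction in `t` over `H`. -/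
theorem proper_fraction_stability {E : Type*} [Field E] [CharZero E] (σ : E ≃+* E)
    (H : Subfield E) (hH : H.map (σ : E →+* E) = H)
    -- H(t) is a ΠΣ*-extension of H
    (t : E) (htrans : Transcendental H t)
    (hconst : constSet σ (adj H t) = constSet σ H)
    (hPS : (σ t - t ∈ H ∧ σ t - t ≠ 0) ∨ σ t / t ∈ H)
    -- the tower H(t) = G₀ ⊆ G₁ ⊆ … ⊆ G_e with generators x₁,…,x_e free of t
    (e : ℕ) (G : ℕ → Subfield E) (x : ℕ → E)
    (hG0 : G 0 = adj H t)
    (hGadj : ∀ i < e, G (i + 1) = adj (G i) (x i))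
    (hxtr : ∀ i < e, Transcendental (G i) (x i))
    (hGconst : ∀ i ≤ e, constSet σ (G i) = constSet σ H)
    (hxPS : ∀ i < e, σ (x i) - x i ∈ adjS H (x '' {j | j < i}) ∨
        (x i ≠ 0 ∧ σ (x i) / x i ∈ adjS H (x '' {j | j < i})))
    -- the telescoping data
    (n : ℕ) (h : Fin n → E) (hh : ∀ i, isProperFrac H t (h i))
    (c : Fin n → E) (hc : ∀ i, c i ∈ constSet σ H)
    (g : E) (hgG : g ∈ G e)
    (hgfrac : isProperFrac (adjS H (x '' {j | j < e})) t g)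
    (heq : σ g - g = ∑ i, c i * h i) :
    g ∈ adj H t ∧ isProperFrac H t g := by
  have ht0 : t ≠ 0 := by
    rintro rfl
    exact htrans isAlgebraic_zero
  have hσH : ∀ a ∈ H, σ a ∈ H := fun a ha => by
    rw [← hH]
    exact ⟨a, ha, rfl⟩
  have hG : ∀ i ≤ e, G i = adj (adjS H (x '' {j | j < i})) t := by
    intro i
    induction i with
    | zero => intro _; rw [hG0, adjS_image_zero]
    | succ i ih => intro hi; rw [hGadj i hi, ih (Nat.le_of_lt hi), adjS_image_succ, adj_comm]
  have htr : ∀ i ≤ e, Transcendental (adjS H (x '' {j | j < i})) t := by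
    intro i
    induction i with
    | zero => intro _; rwa [adjS_image_zero]
    | succ i ih =>
      intro hi
      have hxi := hxtr i hi
      rw [hG i (Nat.le_of_lt hi)] at hxi
      rw [adjS_image_succ]
      exact (ih (Nat.le_of_lt hi)).adj_exchange hxi
  have hσG : ∀ i ≤ e, ∀ a ∈ G i, σ a ∈ G i := by
    intro i
    induction i with
    | zero =>
      intro _
      rw [hG0]
      refine map_mem_adj_of_generators (fun a ha => le_adj (hσH a ha)) ?_
      rcases hPS with ⟨h, -⟩ | h
      · simpa using add_mem (le_adj h) (self_mem_adj (L := H) (t := t))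
      · simpa [ht0] using mul_mem (le_adj h) (self_mem_adj (L := H) (t := t))
    | succ i ih =>
      intro hi
      have hle : adjS H (x '' {j | j < i}) ≤ G i := by
        rw [hG i (Nat.le_of_lt hi)]
        exact le_adj
      rw [hGadj i hi]
      refine map_mem_adj_of_generators (fun a ha => le_adj (ih (Nat.le_of_lt hi) a ha)) ?_
      rcases hxPS i hi with h | ⟨h0, h⟩
      · simpa using add_mem (le_adj (hle h)) (self_mem_adj (L := G i) (t := x i))
      · simpa [h0] using mul_mem (le_adj (hle h)) (self_mem_adj (L := G i) (t := x i))
  have hHle : ∀ i, H ≤ adjS H (x '' {j | j < i}) := fun i z hz =>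
    Subfield.subset_closure (Or.inl hz)
  have hf : ∑ i, c i * h i ∈ adj H t :=
    sum_mem fun i _ => mul_mem (le_adj (hc i).1) (hh i).mem_adj
  have hdesc : ∀ i ≤ e, isProperFrac (adjS H (x '' {j | j < i})) t g → isProperFrac H t g := by
    intro i
    induction i with
    | zero => intro _ hg; rwa [adjS_image_zero] at hg
    | succ i ih =>
      intro hi hg
      refine ih (Nat.le_of_lt hi) ?_
      rw [adjS_image_succ] at hg
      have hGi := hG i (Nat.le_of_lt hi)
      refine isProperFrac_of_telescoping (htr i (Nat.le_of_lt hi)) (hGi ▸ hxtr i hi)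
        (hGi ▸ hσG i (Nat.le_of_lt hi)) (hxPS i hi) ?_ hg (heq ▸ adj_mono (hHle i) hf)
      intro a ha haσ
      rw [← hGi, ← hGadj i hi] at ha
      have : a ∈ constSet σ H := hGconst (i + 1) hi ▸ ⟨ha, haσ⟩
      exact hHle i this.1
  have hg := hdesc e le_rfl hgfrac
  exact ⟨hg.mem_adj, hg⟩
end

section
/- Let (H,σ) be a difference field of characteristic zero with K := const(H,σ), and let H(t) be a Π-extension of (H,σ) with α := σ(t)/t ∈ H. Inside an ambient difference field, let H(t) = G₀ ⊆ G₁ ⊆ … ⊆ G_e be a tower where each G_i = G_{i−1}(x_i), each x_i is transcendental over G_{i−1}, const(G_i,σ) = K, and for every i either σ(x_i) − x_i ∈ H(x₁,…,x_{i−1}) or (x_i ≠ 0 and σ(x_i)/x_i ∈ H(x₁,…,x_{i−1})). Let f₁,…,f_n ∈ H and let r be a positive integer. If g ∈ H(x₁,…,x_e) (the subfield generated by H and x₁,…,x_e) and c₁,…,c_n ∈ K satisfy α^r·σ(g) − g = c₁·f₁ + … + c_n·f_n, then g ∈ H. -/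
open Polynomial in
theorem mem_adj_iff_s13 {E : Type*} [Field E] {L : Subfield E} {x g : E} :
    g ∈ adj L x ↔ ∃ p q : L[X], g = aeval x p / aeval x q := by
  have h : adj L x = (IntermediateField.adjoin L {x}).toSubfield := by
    simp only [adj, IntermediateField.adjoin]
    congr 2
    exact Subtype.range_coe.symm
  rw [h, IntermediateField.mem_toSubfield, IntermediateField.mem_adjoin_simple_iff]

theorem le_adj_s13 {E : Type*} [Field E] (L : Subfield E) (x : E) : L ≤ adj L x :=
  fun _ hy => Subfield.subset_closure (Or.inl hy)

theorem self_mem_adj_s13 {E : Type*} [Field E] (L : Subfield E) (x : E) : x ∈ adj L x :=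
  Subfield.subset_closure (Or.inr rfl)

theorem adj_le {E : Type*} [Field E] {L M : Subfield E} {x : E} (hLM : L ≤ M) (hx : x ∈ M) :
    adj L x ≤ M :=
  Subfield.closure_le.2 (Set.union_subset hLM (Set.singleton_subset_iff.2 hx))

theorem adjS_succ {E : Type*} [Field E] (H : Subfield E) (x : ℕ → E) (i : ℕ) :
    adjS H (x '' {j | j < i + 1}) = adj (adjS H (x '' {j | j < i})) (x i) := by
  have hset : x '' {j | j < i + 1} = x '' {j | j < i} ∪ {x i} := by
    rw [← Set.image_singleton, ← Set.image_union]
    congr 1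
    ext j
    simp [le_iff_eq_or_lt]
  rw [adjS, adj, hset, ← Set.union_assoc, Subfield.closure_union, Subfield.closure_union _ {x i},
    Subfield.closure_eq, adjS]

theorem transcendental_of_le {E : Type*} [Field E] {L M : Subfield E} (hLM : L ≤ M) {x : E}
    (hx : Transcendental M x) : Transcendental L x := by
  intro ⟨p, hp0, hp⟩
  refine hx ⟨p.map (Subfield.inclusion hLM),
    (Polynomial.map_ne_zero_iff (Subfield.inclusion hLM).injective).2 hp0, ?_⟩
  rw [Polynomial.aeval_def, Polynomial.eval₂_map]
  exact hp

open Polynomial in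
/-- Elements of `M ∩ L(x)` lie in `L` when `x` is transcendental over `M ⊇ L`. -/
theorem mem_of_mem_adj_of_transcendental {E : Type*} [Field E] {L M : Subfield E} (hLM : L ≤ M)
    {x y : E} (hx : Transcendental M x) (hyM : y ∈ M) (hy : y ∈ adj L x) : y ∈ L := by
  obtain ⟨p, q, h⟩ := mem_adj_iff_s13.1 hy
  by_cases hq : aeval x q = 0
  · rw [h, hq, div_zero]
    exact L.zero_mem
  have hq0 : q ≠ 0 := by
    rintro rfl
    simp at hq
  rw [eq_div_iff hq] at h
  let ι := Subfield.inclusion hLM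
  have key : C (⟨y, hyM⟩ : M) * q.map ι = p.map ι := by
    apply transcendental_iff_injective.1 hx
    rw [map_mul, aeval_C, aeval_def, eval₂_map, aeval_def, eval₂_map]
    exact h
  have hc := congrArg (fun P => ((P.coeff q.natDegree : M) : E)) key
  simp only [coeff_C_mul, coeff_map, Subfield.coe_mul] at hc
  have hl : ((q.coeff q.natDegree : L) : E) ≠ 0 := by
    simpa using hq0
  rw [eq_div_of_mul_eq hl hc]
  exact L.div_mem (p.coeff _).2 (q.coeff _).2

open Polynomial in
theorem exists_coprime_factorization {F : Type*} [Field F] (p : F[X]) {q : F[X]} (hq : q ≠ 0) :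
    ∃ d p' q' : F[X], d ≠ 0 ∧ IsCoprime p' q' ∧ p = d * p' ∧ q = d * q' := by
  classical
  let := EuclideanDomain.gcdMonoid F[X]
  have hd : gcd p q ≠ 0 := fun h0 => hq ((gcd_eq_zero_iff p q).1 h0).2
  exact ⟨gcd p q, p / gcd p q, q / gcd p q, hd, isCoprime_div_gcd_div_gcd hq,
    (EuclideanDomain.mul_div_cancel' hd (gcd_dvd_left p q)).symm,
    (EuclideanDomain.mul_div_cancel' hd (gcd_dvd_right p q)).symm⟩

open Polynomial in
/-- A reduced representation of the elements of `L(x)`. -/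
theorem exists_coprime_monic_of_mem_adj {E : Type*} [Field E] {L : Subfield E} {x g : E}
    (hx : Transcendental L x) (hg : g ∈ adj L x) :
    ∃ p q : L[X], q.Monic ∧ IsCoprime p q ∧ g * aeval x q = aeval x p := by
  obtain ⟨p, q, h⟩ := mem_adj_iff_s13.1 hg
  by_cases hq : q = 0
  · exact ⟨0, 1, monic_one, isCoprime_one_right, by simp [h, hq]⟩
  obtain ⟨d, p', q', hd, hcop, hp', hq'⟩ := exists_coprime_factorization p hq
  have hq0 : q' ≠ 0 := by
    rintro rfl
    exact hq (by simpa using hq')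
  have hdx : aeval x d ≠ 0 := fun h0 => hd ((transcendental_iff.1 hx) d h0)
  have hqx : aeval x q' ≠ 0 := fun h0 => hq0 ((transcendental_iff.1 hx) q' h0)
  have hu : IsUnit (C q'.leadingCoeff⁻¹) :=
    isUnit_C.2 (isUnit_iff_ne_zero.2 (inv_ne_zero (leadingCoeff_ne_zero.2 hq0)))
  refine ⟨p' * C q'.leadingCoeff⁻¹, q' * C q'.leadingCoeff⁻¹,
    monic_mul_leadingCoeff_inv hq0, ?_, ?_⟩
  · exact (isCoprime_mul_unit_right hu p' q').2 hcop
  · rw [h, hp', hq']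
    simp only [map_mul]
    field_simp

open Polynomial in
/-- The action of a field endomorphism `σ` with `σ(x) = βx + γ` on polynomials in `x`. -/
noncomputable def affineTwist {F : Type*} [Field F] (s : F →+* F) (β γ : F) (p : F[X]) : F[X] :=
  (p.map s).comp (C β * X + C γ)

open Polynomial in
theorem aeval_affineTwist {E : Type*} [Field E] (σ : E ≃+* E) {L : Subfield E} (s : L →+* L)
    (hs : ∀ y, (s y : E) = σ y) {β γ : L} {x : E} (hx : σ x = β * x + γ) (p : L[X]) :
    aeval x (affineTwist s β γ p) = σ (aeval x p) := by
  have hsc : (algebraMap L E).comp s = (σ : E →+* E).comp (algebraMap L E) := RingHom.ext hs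
  rw [affineTwist, aeval_comp, aeval_def, eval₂_map, aeval_def, hsc]
  refine Eq.trans ?_ (hom_eval₂ p (algebraMap L E) (σ : E →+* E) x).symm
  congr 1
  rw [eval₂_add, eval₂_mul, eval₂_C, eval₂_C, eval₂_X]
  exact hx.symm

open Polynomial in
theorem natDegree_affineTwist {F : Type*} [Field F] (s : F →+* F) {β : F} (hβ : β ≠ 0) (γ : F)
    (p : F[X]) : (affineTwist s β γ p).natDegree = p.natDegree := by
  rw [affineTwist, natDegree_comp, natDegree_map, natDegree_linear hβ, mul_one]

open Polynomial in
theorem leadingCoeff_affineTwist {F : Type*} [Field F] (s : F →+* F) {β : F} (hβ : β ≠ 0) (γ : F)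
    (p : F[X]) :
    (affineTwist s β γ p).leadingCoeff = s p.leadingCoeff * β ^ p.natDegree := by
  rw [affineTwist, leadingCoeff_comp (by rw [natDegree_linear hβ]; exact one_ne_zero),
    leadingCoeff_map, natDegree_map, leadingCoeff_linear hβ]

open Polynomial in
/-- The denominator of a rational solution of `a·σ(g) - g = f` is semi-invariant. -/
theorem affineTwist_eq_of_coprime {F : Type*} [Field F] {s : F →+* F} {β γ a f : F} (hβ : β ≠ 0)
    {p q : F[X]} (hq : q.Monic) (hpq : IsCoprime p q)
    (h : C a * affineTwist s β γ p * q = (p + C f * q) * affineTwist s β γ q) :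
    affineTwist s β γ q = C (β ^ q.natDegree) * q := by
  have hcop : IsCoprime q (p + C f * q) := (hpq.add_mul_right_left (C f)).symm
  obtain ⟨u, hu⟩ : q ∣ affineTwist s β γ q :=
    hcop.dvd_of_dvd_mul_left ⟨_, h.symm.trans (mul_comm _ _)⟩
  have hlc := leadingCoeff_affineTwist s hβ γ q
  have hdeg := natDegree_affineTwist s hβ γ q
  rw [hu, leadingCoeff_mul, hq.leadingCoeff, one_mul, map_one, one_mul] at hlc
  have hu0 : u ≠ 0 := by
    rintro rfl
    rw [leadingCoeff_zero] at hlc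
    exact pow_ne_zero _ hβ hlc.symm
  rw [hu, natDegree_mul hq.ne_zero hu0, Nat.add_eq_left] at hdeg
  rw [hu, ← hlc, mul_comm, leadingCoeff, hdeg, ← eq_C_of_natDegree_eq_zero hdeg]

open Polynomial in
/-- Adjoining one sum or product generator `x` gives no new solution of `a·σ(g) - g = f`, provided
`a = σ(τ)/τ` for some `τ ∈ M` outside `L` and `M(x)` has no constants outside `L`. -/
theorem mem_of_mem_adj_of_mul_map_sub_mem {E : Type*} [Field E] (σ : E ≃+* E) {L M : Subfield E}
    (hLM : L ≤ M) (hσL : ∀ y ∈ L, σ y ∈ L) {x τ a g : E} (hxM : Transcendental M x)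
    (hconst : ∀ y ∈ adj M x, σ y = y → y ∈ L)
    (hx : σ x - x ∈ L ∨ (x ≠ 0 ∧ σ x / x ∈ L))
    (hτM : τ ∈ M) (hτL : τ ∉ L) (ha : a ∈ L) (hτ : σ τ = a * τ)
    (hg : g ∈ adj L x) (hf : a * σ g - g ∈ L) : g ∈ L := by
  have hxL := transcendental_of_le hLM hxM
  have hinj : Function.Injective (aeval (R := L) x) := transcendental_iff_injective.1 hxL
  have hτ0 : τ ≠ 0 := fun h => hτL (h ▸ L.zero_mem)
  let s : L →+* L := ((σ : E →+* E).comp L.subtype).codRestrict L fun y => hσL y y.2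
  have hs : ∀ y, (s y : E) = σ y := fun _ => rfl
  have hM : ∀ p : L[X], aeval x p ∈ adj M x := fun p =>
    adj_le (hLM.trans (le_adj_s13 M x)) (self_mem_adj_s13 M x) (mem_adj_iff_s13.2 ⟨p, 1, by simp⟩)
  obtain ⟨p, q, hq, hpq, hgq⟩ := exists_coprime_monic_of_mem_adj hxL hg
  have hq0 : aeval x q ≠ 0 := fun h => hq.ne_zero ((transcendental_iff.1 hxL) q h)
  lift a to L using ha
  obtain ⟨f, hf⟩ : ∃ f : L, (f : E) = a * σ g - g := ⟨⟨_, hf⟩, rfl⟩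
  have main : ∀ β γ : L, σ x = β * x + γ →
      C a * affineTwist s β γ p * q = (p + C f * q) * affineTwist s β γ q := by
    intro β γ hβγ
    apply hinj
    simp only [map_mul, map_add, aeval_C, aeval_affineTwist σ s hs hβγ, ← hgq]
    change (a : E) * _ * _ = (_ + (f : E) * _) * _
    rw [hf]
    ring
  have hmem : ∀ c : L, g * aeval x q = c * aeval x q → g ∈ L := fun c h =>
    mul_right_cancel₀ hq0 h ▸ c.2
  rcases hx with hx | ⟨hx0, hx⟩
  · obtain ⟨γ, hγ⟩ : ∃ γ : L, (γ : E) = σ x - x := ⟨⟨_, hx⟩, rfl⟩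
    have hβγ : σ x = (1 : L) * x + γ := by simp [hγ]
    have heq := main 1 γ hβγ
    have hSq := affineTwist_eq_of_coprime one_ne_zero hq hpq heq
    rw [one_pow, C_1, one_mul] at hSq
    have hQ : aeval x q ∈ L := by
      refine hconst _ (hM q) ?_
      rw [← aeval_affineTwist σ s hs hβγ, hSq]
    have hqC : q = C ⟨_, hQ⟩ := hinj (by rw [aeval_C]; rfl)
    have hq1 : q = 1 := hq.natDegree_eq_zero.1 (by rw [hqC, natDegree_C])
    rw [hSq, hq1, mul_one, mul_one] at heq
    by_cases hp : p.natDegree = 0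
    · apply hmem (p.coeff 0)
      rw [hgq, hq1, map_one, mul_one]
      nth_rw 1 [eq_C_of_natDegree_eq_zero hp, aeval_C]
      rfl
    · exfalso
      have hc := congrArg (fun P => P.coeff p.natDegree) heq
      have hlc := leadingCoeff_affineTwist s one_ne_zero γ p
      rw [leadingCoeff, natDegree_affineTwist s one_ne_zero, one_pow, mul_one] at hlc
      simp only [coeff_C_mul, hlc, coeff_add, mul_one, coeff_C_of_ne_zero hp, add_zero,
        coeff_natDegree] at hc
      have hl0 : (p.leadingCoeff : E) ≠ 0 := by
        have : p ≠ 0 := fun h => hp (by simp [h])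
        simpa using this
      have hcE : (a : E) * σ p.leadingCoeff = p.leadingCoeff := congrArg Subtype.val hc
      have hw : τ * p.leadingCoeff ∈ L := by
        refine hconst _ (le_adj_s13 M x (M.mul_mem hτM (hLM p.leadingCoeff.2))) ?_
        rw [map_mul, hτ]
        linear_combination τ * hcE
      exact hτL (by simpa [hl0] using L.div_mem hw p.leadingCoeff.2)
  · obtain ⟨β, hβ⟩ : ∃ β : L, (β : E) = σ x / x := ⟨⟨_, hx⟩, rfl⟩
    have hβx : σ x = β * x := by rw [hβ, div_mul_cancel₀ _ hx0]
    have hβγ : σ x = β * x + (0 : L) := by simp [hβx]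
    have hβ0E : (β : E) ≠ 0 := by
      rw [hβ]
      exact div_ne_zero ((map_ne_zero σ).2 hx0) hx0
    have hβ0 : β ≠ 0 := fun h => hβ0E (by simp [h])
    have heq := main β 0 hβγ
    have hSq := affineTwist_eq_of_coprime hβ0 hq hpq heq
    set m := q.natDegree
    have hσq : σ (aeval x q) = (β : E) ^ m * aeval x q := by
      rw [← aeval_affineTwist σ s hs hβγ, hSq, map_mul, aeval_C, map_pow]
      rfl
    have hQ : aeval x q / x ^ m ∈ L := by
      refine hconst _ ((adj M x).div_mem (hM q) ((adj M x).pow_mem (self_mem_adj_s13 M x) m)) ?_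
      rw [map_div₀, map_pow, hσq, hβx, mul_pow, mul_div_mul_left _ _ (pow_ne_zero _ hβ0E)]
    have hqC : q = C ⟨_, hQ⟩ * X ^ m := hinj (by
      rw [map_mul, aeval_C, map_pow, aeval_X]
      exact (div_mul_cancel₀ _ (pow_ne_zero _ hx0)).symm)
    have hqX : q = X ^ m := by
      have h1 := congrArg leadingCoeff hqC
      rw [hq.leadingCoeff, leadingCoeff_mul_X_pow, leadingCoeff_C] at h1
      rw [hqC, ← h1, C_1, one_mul]
    have heq' : C a * affineTwist s β 0 p = (p + C f * q) * C (β ^ m) := by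
      apply mul_right_cancel₀ hq.ne_zero
      rw [heq, hSq, mul_assoc]
    have hcoeff : ∀ k, k ≠ m → p.coeff k = 0 := by
      intro k hk
      by_contra hpk
      have hc := congrArg (fun P => ((P.coeff k : L) : E)) heq'
      simp only [coeff_C_mul, coeff_mul_C, affineTwist, C_0, add_zero, comp_C_mul_X_coeff,
        coeff_map, coeff_add, hqX, coeff_X_pow, if_neg hk, mul_zero, Subfield.coe_mul,
        SubmonoidClass.coe_pow, hs] at hc
      have hw : τ * p.coeff k * x ^ k / x ^ m ∈ L := by
        refine hconst _ ((adj M x).div_mem ((adj M x).mul_mem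
          (le_adj_s13 M x (M.mul_mem hτM (hLM (p.coeff k).2))) ((adj M x).pow_mem (self_mem_adj_s13 M x) k))
          ((adj M x).pow_mem (self_mem_adj_s13 M x) m)) ?_
        simp only [map_div₀, map_mul, map_pow, hβx, hτ, mul_pow]
        rw [div_eq_div_iff (mul_ne_zero (pow_ne_zero _ hβ0E) (pow_ne_zero _ hx0))
          (pow_ne_zero _ hx0)]
        linear_combination τ * x ^ k * x ^ m * hc
      have hP : C (⟨τ * p.coeff k, M.mul_mem hτM (hLM (p.coeff k).2)⟩ : M) * X ^ k =
          C (⟨_, hLM hw⟩ : M) * X ^ m := by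
        apply transcendental_iff_injective.1 hxM
        simp only [map_mul, aeval_C, map_pow, aeval_X]
        exact (div_mul_cancel₀ _ (pow_ne_zero _ hx0)).symm
      have h1 := congrArg (fun P => ((P.coeff k : M) : E)) hP
      simp [coeff_X_pow, hk, hτ0, hpk] at h1
    have hp : p = C (p.coeff m) * X ^ m := by
      ext k
      by_cases hk : k = m
      · simp [hk]
      · simp [hk, hcoeff k hk, coeff_X_pow]
    apply hmem (p.coeff m)
    rw [hgq, hqX]
    nth_rw 1 [hp]
    rw [map_mul, aeval_C]
    rfl

/-- For a Π-extension `H(t)` with `α = σ(t)/t ∈ H` and `r > 0`, solutions of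
`α^r·σ(g) - g = Σ cᵢ·fᵢ` (with `fᵢ ∈ H`) in any ΠΣ*-extension of `H(t)` over `H`
whose part `g` lies in `H(x₁,…,x_e)` must already lie in `H`. -/
theorem no_ext_for_pi {E : Type*} [Field E] [CharZero E] (σ : E ≃+* E)
    (H : Subfield E) (hH : H.map (σ : E →+* E) = H)
    -- H(t) is a Π-extension of H with α = σ(t)/t ∈ H
    (t α : E) (hα : α ∈ H) (hα0 : α ≠ 0) (hσt : σ t = α * t)
    (htrans : Transcendental H t)
    (hconst : constSet σ (adj H t) = constSet σ H)
    -- the tower H(t) = G₀ ⊆ G₁ ⊆ … ⊆ G_e with generators x₁,…,x_e free of t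
    (e : ℕ) (G : ℕ → Subfield E) (x : ℕ → E)
    (hG0 : G 0 = adj H t)
    (hGadj : ∀ i < e, G (i + 1) = adj (G i) (x i))
    (hxtr : ∀ i < e, Transcendental (G i) (x i))
    (hGconst : ∀ i ≤ e, constSet σ (G i) = constSet σ H)
    (hxPS : ∀ i < e, σ (x i) - x i ∈ adjS H (x '' {j | j < i}) ∨
        (x i ≠ 0 ∧ σ (x i) / x i ∈ adjS H (x '' {j | j < i})))
    -- the data
    (n : ℕ) (f : Fin n → E) (hf : ∀ i, f i ∈ H)
    (r : ℕ) (hr : 0 < r)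
    (g : E) (hg : g ∈ adjS H (x '' {j | j < e}))
    (c : Fin n → E) (hc : ∀ i, c i ∈ constSet σ H)
    (heq : α ^ r * σ g - g = ∑ i, c i * f i) :
    g ∈ H := by
  have hL0 : adjS H (x '' {j | j < 0}) = H := by simp [adjS, Subfield.closure_eq]
  have hHL : ∀ i, H ≤ adjS H (x '' {j | j < i}) := fun i y hy => Subfield.subset_closure (Or.inl hy)
  have hG : ∀ i ≤ e, t ∈ G i ∧ adjS H (x '' {j | j < i}) ≤ G i := by
    intro i
    induction i with
    | zero =>
      intro _
      rw [hL0, hG0]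
      exact ⟨self_mem_adj_s13 H t, le_adj_s13 H t⟩
    | succ i ih =>
      intro hi
      obtain ⟨ht, hle⟩ := ih (by omega)
      rw [hGadj i hi, adjS_succ]
      exact ⟨le_adj_s13 _ _ ht, adj_le (hle.trans (le_adj_s13 _ _)) (self_mem_adj_s13 _ _)⟩
  have hσ : ∀ i ≤ e, ∀ y ∈ adjS H (x '' {j | j < i}), σ y ∈ adjS H (x '' {j | j < i}) := by
    intro i
    induction i with
    | zero =>
      intro _ y hy
      rw [hL0] at hy ⊢
      rw [← hH]
      exact ⟨y, hy, rfl⟩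
    | succ i ih =>
      intro hi y hy
      have hL := le_adj_s13 (adjS H (x '' {j | j < i})) (x i)
      have hxi := self_mem_adj_s13 (adjS H (x '' {j | j < i})) (x i)
      rw [adjS_succ] at hy ⊢
      refine adj_le (M := (adj (adjS H (x '' {j | j < i})) (x i)).comap (σ : E →+* E))
        (fun z hz => hL (ih (by omega) z hz)) ?_ hy
      change σ (x i) ∈ adj _ _
      rcases hxPS i hi with h | ⟨h0, h⟩
      · simpa using Subfield.add_mem _ (hL h) hxi
      · simpa [h0] using Subfield.mul_mem _ (hL h) hxi
  have htH : t ^ r ∉ H := fun h => by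
    refine htrans.pow hr ?_
    exact isAlgebraic_algebraMap (⟨t ^ r, h⟩ : H)
  have htr : ∀ i ≤ e, t ^ r ∉ adjS H (x '' {j | j < i}) := by
    intro i
    induction i with
    | zero => rwa [hL0, imp_iff_right (Nat.zero_le e)]
    | succ i ih =>
      intro hi h
      rw [adjS_succ] at h
      obtain ⟨ht, hle⟩ := hG i (by omega)
      exact ih (by omega)
        (mem_of_mem_adj_of_transcendental hle (hxtr i hi) ((G i).pow_mem ht r) h)
  have hrhs : α ^ r * σ g - g ∈ H := by
    rw [heq]
    exact H.sum_mem fun i _ => H.mul_mem (hc i).1 (hf i)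
  have descent : ∀ i ≤ e, g ∈ adjS H (x '' {j | j < i}) → g ∈ H := by
    intro i
    induction i with
    | zero => exact fun _ h => by rwa [hL0] at h
    | succ i ih =>
      intro hi h
      rw [adjS_succ] at h
      obtain ⟨ht, hle⟩ := hG i (by omega)
      refine ih (by omega) (mem_of_mem_adj_of_mul_map_sub_mem σ hle (hσ i (by omega)) (hxtr i hi)
        (fun y hy hy' => hHL i ?_) (hxPS i hi) ((G i).pow_mem ht r) (htr i (by omega))
        (hHL i (H.pow_mem hα r)) (by rw [map_pow, hσt, mul_pow]) h (hHL i hrhs))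
      have hyc : y ∈ constSet σ (G (i + 1)) := ⟨hGadj i hi ▸ hy, hy'⟩
      rw [hGconst (i + 1) hi] at hyc
      exact hyc.1
  exact descent e le_rfl hg
end
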